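/- Let r > 0 and let θ, φ be real numbers with 0 < θ < π/2 and 0 < φ < π/2. Define F(s) = (π/r)^{−2s}·[ζ(2s, θ/π) + ζ(2s, 1 − θ/π) − ζ(2s, φ/π) − ζ(2s, 1 − φ/π)], where ζ is the Hurwitz zeta function. Then F is differentiable at s = 0, F'(0) = 2·log(sin φ / sin θ), and consequently exp(−F'(0)) = sin²θ / sin²φ. -/

import Mathlib

section

open Filter Topology HurwitzZeta

lemma one_sub_mul_tsum_pow_mul {w : ℂ} {u : ℕ → ℂ}
    (h : Summable fun n : ℕ => w ^ (n + 1) * u n) :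
    (1 - w) * ∑' n : ℕ, w ^ (n + 1) * u n =
      w * u 0 + ∑' n : ℕ, w ^ (n + 2) * (u (n + 1) - u n) := by
  have h1 : Summable fun n : ℕ => w ^ (n + 2) * u (n + 1) :=
    (summable_nat_add_iff (f := fun n : ℕ => w ^ (n + 1) * u n) 1).2 h
  have h2 : Summable fun n : ℕ => w ^ (n + 2) * u n :=
    (h.mul_left w).congr fun n => by ring
  simp_rw [mul_sub]
  rw [h1.tsum_sub h2, sub_mul, one_mul, ← tsum_mul_left, h.tsum_eq_zero_add]
  have : ∀ n : ℕ, w * (w ^ (n + 1) * u n) = w ^ (n + 2) * u n := fun n => by ring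
  simp_rw [this]
  simp only [zero_add, pow_one]
  ring

lemma abs_rpow_neg_sub_rpow_neg_le {x s : ℝ} (hx : 1 ≤ x) (hs : s ∈ Set.Icc (1 : ℝ) 2) :
    |(x + 1) ^ (-s) - x ^ (-s)| ≤ 2 / x ^ 2 := by
  have hx0 : 0 < x := by linarith
  have hle : (x + 1) ^ (-s) ≤ x ^ (-s) :=
    Real.rpow_le_rpow_of_nonpos hx0 (by linarith) (by linarith [hs.1])
  have hq : 0 < x / (x + 1) := by positivity
  have hsplit : (x + 1) ^ (-s) = x ^ (-s) * (x / (x + 1)) ^ s := by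
    rw [Real.div_rpow hx0.le (by positivity), Real.rpow_neg hx0.le, Real.rpow_neg (by positivity)]
    have := (Real.rpow_pos_of_pos hx0 s).ne'
    field_simp
  have h1 : x ^ (-s) ≤ x⁻¹ := by
    rw [← Real.rpow_neg_one]
    exact Real.rpow_le_rpow_of_exponent_le hx (by linarith [hs.1])
  have h2 : (x / (x + 1)) ^ 2 ≤ (x / (x + 1)) ^ s := by
    rw [← Real.rpow_two]
    exact Real.rpow_le_rpow_of_exponent_ge hq ((div_le_one (by positivity)).2 (by linarith)) hs.2
  have h3 : (x / (x + 1)) ^ 2 ≤ 1 :=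
    pow_le_one₀ hq.le ((div_le_one (by positivity)).2 (by linarith))
  rw [abs_sub_comm, abs_of_nonneg (by linarith), hsplit]
  calc x ^ (-s) - x ^ (-s) * (x / (x + 1)) ^ s = x ^ (-s) * (1 - (x / (x + 1)) ^ s) := by ring
    _ ≤ x ^ (-s) * (1 - (x / (x + 1)) ^ 2) := by gcongr
    _ ≤ x⁻¹ * (1 - (x / (x + 1)) ^ 2) := by gcongr
    _ ≤ 2 / x ^ 2 := by
      have : 2 / x ^ 2 - x⁻¹ * (1 - (x / (x + 1)) ^ 2) = (3 * x + 2) / (x ^ 2 * (x + 1) ^ 2) := by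
        field_simp
        ring
      have : 0 ≤ (3 * x + 2) / (x ^ 2 * (x + 1) ^ 2) := by positivity
      linarith

/-- Summation by parts turns the polylogarithm series into one converging absolutely and locally
uniformly up to `s = 1`, `‖w‖ = 1`. -/
noncomputable def regularizedPolylog (w : ℂ) (s : ℝ) : ℂ :=
  w + ∑' n : ℕ, w ^ (n + 2) * ((((n + 1 : ℝ) + 1) ^ (-s) - (n + 1 : ℝ) ^ (-s) : ℝ) : ℂ)

lemma one_sub_mul_tsum_eq_regularizedPolylog {w : ℂ} {s : ℝ}
    (h : Summable fun n : ℕ => w ^ (n + 1) * (((n + 1 : ℝ) ^ (-s) : ℝ) : ℂ)) :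
    (1 - w) * ∑' n : ℕ, w ^ (n + 1) * (((n + 1 : ℝ) ^ (-s) : ℝ) : ℂ) =
      regularizedPolylog w s := by
  rw [one_sub_mul_tsum_pow_mul h, regularizedPolylog]
  congr 1
  · simp
  · refine tsum_congr fun n => ?_
    push_cast
    rfl

lemma continuousOn_regularizedPolylog :
    ContinuousOn (fun p : ℂ × ℝ => regularizedPolylog p.1 p.2)
      (Metric.closedBall 0 1 ×ˢ Set.Icc 1 2) := by
  unfold regularizedPolylog
  refine continuousOn_fst.add (continuousOn_tsum (u := fun n : ℕ => 2 / (n + 1 : ℝ) ^ 2) ?_ ?_ ?_)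
  · intro n
    have h1 : ContinuousOn (fun p : ℂ × ℝ => ((n + 1 : ℝ) + 1) ^ (-p.2))
        (Metric.closedBall 0 1 ×ˢ Set.Icc 1 2) :=
      continuousOn_const.rpow continuousOn_snd.neg fun _ _ => Or.inl (by positivity)
    have h2 : ContinuousOn (fun p : ℂ × ℝ => (n + 1 : ℝ) ^ (-p.2))
        (Metric.closedBall 0 1 ×ˢ Set.Icc 1 2) :=
      continuousOn_const.rpow continuousOn_snd.neg fun _ _ => Or.inl (by positivity)
    exact (continuousOn_fst.pow _).mul (Complex.continuous_ofReal.comp_continuousOn (h1.sub h2))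
  · have := (summable_nat_add_iff 1).2 (Real.summable_one_div_nat_pow.2 one_lt_two)
    simpa [div_eq_mul_inv] using this.mul_left 2
  · rintro n ⟨w, s⟩ ⟨hw, hs⟩
    rw [norm_mul, norm_pow, Complex.norm_real, Real.norm_eq_abs]
    have hw' : ‖w‖ ≤ 1 := by simpa using hw
    calc _ ≤ 1 * (2 / (n + 1 : ℝ) ^ 2) := by
          gcongr
          · exact pow_le_one₀ (norm_nonneg _) hw'
          · exact abs_rpow_neg_sub_rpow_neg_le (by simp) hs
      _ = _ := one_mul _

lemma regularizedPolylog_one_of_norm_lt_one {w : ℂ} (hw : ‖w‖ < 1) :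
    regularizedPolylog w 1 = -((1 - w) * Complex.log (1 - w)) := by
  have h' : HasSum (fun n : ℕ => w ^ (n + 1) * (((n + 1 : ℝ) ^ (-(1 : ℝ)) : ℝ) : ℂ))
      (-Complex.log (1 - w)) := by
    convert! Complex.hasSum_taylorSeries_neg_log' hw using 2 with n
    rw [Real.rpow_neg_one]
    push_cast
    rfl
  rw [← one_sub_mul_tsum_eq_regularizedPolylog h'.summable, h'.tsum_eq, mul_neg]

lemma regularizedPolylog_one {z : ℂ} (hz : ‖z‖ = 1) (hz1 : z ≠ 1) :
    regularizedPolylog z 1 = -((1 - z) * Complex.log (1 - z)) := by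
  have hmem : 1 - z ∈ Complex.slitPlane := by
    refine Or.inl ?_
    have hre : z.re ≤ 1 := hz ▸ Complex.re_le_norm z
    rcases hre.lt_or_eq with h | h
    · simpa using h
    · refine absurd (Complex.ext h ?_) hz1
      have := Complex.sq_norm z
      rw [hz, Complex.normSq_apply, h] at this
      simpa using this
  have hx : Tendsto (fun x : ℝ => (x : ℂ) * z) (𝓝[<] 1) (𝓝 z) := by
    have : Continuous fun x : ℝ => (x : ℂ) * z := by fun_prop
    simpa using (this.tendsto 1).mono_left nhdsWithin_le_nhds
  have hev : ∀ᶠ x : ℝ in 𝓝[<] 1, ‖(x : ℂ) * z‖ < 1 := by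
    filter_upwards [Ioo_mem_nhdsLT (zero_lt_one' ℝ)] with x hx
    simpa [hz, abs_of_pos hx.1] using hx.2
  have hlim : Tendsto (fun x : ℝ => regularizedPolylog (x * z) 1) (𝓝[<] 1)
      (𝓝 (regularizedPolylog z 1)) := by
    have hc := continuousOn_regularizedPolylog (z, 1) ⟨by simp [hz], by simp⟩
    refine hc.tendsto.comp (tendsto_nhdsWithin_iff.2 ⟨hx.prodMk_nhds tendsto_const_nhds, ?_⟩)
    filter_upwards [hev] with x hx
    exact ⟨by simpa using hx.le, by simp⟩
  have hlog : Tendsto (fun x : ℝ => -((1 - x * z) * Complex.log (1 - x * z))) (𝓝[<] 1)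
      (𝓝 (-((1 - z) * Complex.log (1 - z)))) := by
    have h1 := hx.const_sub 1
    exact (h1.mul (h1.clog hmem)).neg
  refine tendsto_nhds_unique hlim (hlog.congr' ?_)
  filter_upwards [hev] with x hx
  exact (regularizedPolylog_one_of_norm_lt_one hx).symm

lemma exp_two_pi_mul_I_ne_one {a : ℝ} (ha : (a : UnitAddCircle) ≠ 0) :
    Complex.exp (2 * Real.pi * Complex.I * a) ≠ 1 := by
  rw [Ne, Complex.exp_eq_one_iff]
  rintro ⟨n, hn⟩
  refine ha ((AddCircle.coe_eq_zero_iff 1).2 ⟨n, ?_⟩)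
  rw [mul_comm] at hn
  have : (a : ℂ) = n := mul_right_cancel₀ Complex.two_pi_I_ne_zero hn
  rw [zsmul_one]
  exact_mod_cast this.symm

lemma one_sub_exp_mul_expZeta_eq_regularizedPolylog (a : ℝ) {s : ℝ} (hs : 1 < s) :
    (1 - Complex.exp (2 * Real.pi * Complex.I * a)) * expZeta a s =
      regularizedPolylog (Complex.exp (2 * Real.pi * Complex.I * a)) s := by
  have h := (hasSum_nat_add_iff' 1).2 (hasSum_expZeta_of_one_lt_re a (s := s) (by simpa using hs))
  have h' : HasSum (fun n : ℕ => Complex.exp (2 * Real.pi * Complex.I * a) ^ (n + 1) *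
      (((n + 1 : ℝ) ^ (-s) : ℝ) : ℂ)) (expZeta a s) := by
    convert! h using 1
    · ext n
      rw [← Complex.exp_nat_mul, Complex.ofReal_cpow (by positivity), Complex.ofReal_neg,
        Complex.cpow_neg, div_eq_mul_inv]
      push_cast
      congr 2
      ring
    · have : s ≠ 0 := by linarith
      simp [this]
  rw [← one_sub_mul_tsum_eq_regularizedPolylog h'.summable, h'.tsum_eq]

lemma expZeta_one {a : ℝ} (ha : (a : UnitAddCircle) ≠ 0) :
    expZeta a 1 = -Complex.log (1 - Complex.exp (2 * Real.pi * Complex.I * a)) := by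
  set z := Complex.exp (2 * Real.pi * Complex.I * a) with hz
  have hz1 : z ≠ 1 := exp_two_pi_mul_I_ne_one ha
  have hnorm : ‖z‖ = 1 := by
    rw [hz, show 2 * Real.pi * Complex.I * a = ((2 * Real.pi * a : ℝ) : ℂ) * Complex.I by
      push_cast; ring, Complex.norm_exp_ofReal_mul_I]
  have hlim : Tendsto (fun s : ℝ => regularizedPolylog z s) (𝓝[>] 1)
      (𝓝 (regularizedPolylog z 1)) := by
    have hc := continuousOn_regularizedPolylog (z, 1) ⟨by simp [hnorm], by simp⟩
    refine hc.tendsto.comp (tendsto_nhdsWithin_iff.2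
      ⟨tendsto_const_nhds.prodMk_nhds (tendsto_id.mono_left nhdsWithin_le_nhds), ?_⟩)
    filter_upwards [Ioo_mem_nhdsGT (one_lt_two : (1 : ℝ) < 2)] with s hs
    exact ⟨by simp [hnorm], hs.1.le, hs.2.le⟩
  have hzeta : Tendsto (fun s : ℝ => (1 - z) * expZeta a s) (𝓝[>] 1)
      (𝓝 ((1 - z) * expZeta a 1)) := by
    have hcont : Continuous fun s : ℝ => (1 - z) * expZeta a s :=
      continuous_const.mul
        ((differentiable_expZeta_of_ne_zero ha).continuous.comp Complex.continuous_ofReal)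
    simpa using (hcont.tendsto 1).mono_left nhdsWithin_le_nhds
  have heq : (1 - z) * expZeta a 1 = regularizedPolylog z 1 := by
    refine tendsto_nhds_unique hzeta (hlim.congr' ?_)
    filter_upwards [self_mem_nhdsWithin] with s hs
    exact (one_sub_exp_mul_expZeta_eq_regularizedPolylog a hs).symm
  rw [regularizedPolylog_one hnorm hz1, ← mul_neg] at heq
  exact mul_left_cancel₀ (sub_ne_zero.2 hz1.symm) heq

lemma coe_unitAddCircle_ne_zero {a : ℝ} (ha : a ∈ Set.Ioo (0 : ℝ) 1) :
    (a : UnitAddCircle) ≠ 0 := by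
  rw [Ne, AddCircle.coe_eq_zero_iff]
  rintro ⟨n, rfl⟩
  rw [zsmul_one] at ha
  obtain ⟨h0, h1⟩ := ha
  have h0' : 0 < n := by exact_mod_cast h0
  have h1' : n < 1 := by exact_mod_cast h1
  omega

lemma cosZeta_one {a : ℝ} (ha : a ∈ Set.Ioo (0 : ℝ) 1) :
    cosZeta a 1 = -(Real.log (2 * Real.sin (Real.pi * a)) : ℂ) := by
  have hne := coe_unitAddCircle_ne_zero ha
  have hsin : 0 < Real.sin (Real.pi * a) :=
    Real.sin_pos_of_pos_of_lt_pi (by have := ha.1; positivity)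
      (by nlinarith [Real.pi_pos, ha.2])
  have hne' : ((-a : ℝ) : UnitAddCircle) ≠ 0 := by simpa using hne
  have hneg : expZeta (-(a : UnitAddCircle)) 1 =
      -Complex.log (1 - Complex.exp (2 * Real.pi * Complex.I * (-a : ℝ))) := by
    rw [← expZeta_one hne', AddCircle.coe_neg]
  set w := 1 - Complex.exp (2 * Real.pi * Complex.I * a) with hw
  have hre : w.re = 2 * Real.sin (Real.pi * a) ^ 2 := by
    rw [hw, show 2 * Real.pi * Complex.I * a = ((2 * (Real.pi * a) : ℝ) : ℂ) * Complex.I by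
      push_cast; ring, Complex.sub_re, Complex.exp_ofReal_mul_I_re, Real.cos_two_mul,
      Real.cos_sq', Complex.one_re]
    ring
  have him : w.im = -(2 * Real.sin (Real.pi * a) * Real.cos (Real.pi * a)) := by
    rw [hw, show 2 * Real.pi * Complex.I * a = ((2 * (Real.pi * a) : ℝ) : ℂ) * Complex.I by
      push_cast; ring, Complex.sub_im, Complex.exp_ofReal_mul_I_im, Real.sin_two_mul,
      Complex.one_im, zero_sub]
  have hconj : 1 - Complex.exp (2 * Real.pi * Complex.I * (-a : ℝ)) =
      (starRingEnd ℂ) w := by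
    rw [hw, map_sub, map_one, ← Complex.exp_conj]
    simp [Complex.conj_ofNat]
  have harg : w.arg ≠ Real.pi := by
    rw [Ne, Complex.arg_eq_pi_iff, hre]
    rintro ⟨h, -⟩
    linarith [pow_pos hsin 2]
  have hnorm : ‖w‖ = 2 * Real.sin (Real.pi * a) := by
    rw [← sq_eq_sq₀ (norm_nonneg _) (by positivity), Complex.sq_norm, Complex.normSq_apply, hre,
      him]
    linear_combination (4 * Real.sin (Real.pi * a) ^ 2) * Real.sin_sq_add_cos_sq (Real.pi * a)
  rw [cosZeta_eq, expZeta_one hne, hneg, hconj, Complex.log_conj _ harg, ← hw, ← neg_add,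
    Complex.add_conj, Complex.log_re, hnorm]
  push_cast
  ring

lemma hasDerivAt_hurwitzZetaEven_zero {a : UnitAddCircle} (ha : a ≠ 0) :
    HasDerivAt (hurwitzZetaEven a) (cosZeta a 1 / 2) 0 := by
  have hfe : hurwitzZetaEven a =ᶠ[𝓝 0] fun u : ℂ =>
      2 * (2 * Real.pi) ^ (-(1 - u)) * Complex.Gamma (1 - u) * cosZeta a (1 - u) *
        Complex.sin (Real.pi * u / 2) := by
    filter_upwards [Metric.ball_mem_nhds (0 : ℂ) one_pos] with u hu
    have hu' : ∀ n : ℕ, 1 - u ≠ -n := by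
      intro n hn
      have h1 : u = ((n + 1 : ℕ) : ℂ) := by
        push_cast
        linear_combination -hn
      rw [mem_ball_zero_iff, h1, Complex.norm_natCast] at hu
      have : n + 1 < 1 := by exact_mod_cast hu
      omega
    have h := hurwitzZetaEven_one_sub a hu' (Or.inl ha)
    rw [sub_sub_cancel] at h
    rw [h, show (Real.pi : ℂ) * (1 - u) / 2 = Real.pi / 2 - Real.pi * u / 2 by ring,
      Complex.cos_pi_div_two_sub]
    ring
  refine HasDerivAt.congr_of_eventuallyEq ?_ hfe
  have hπ : (2 * Real.pi : ℂ) ≠ 0 := by simp [Real.pi_ne_zero]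
  have hsub : DifferentiableAt ℂ (fun u : ℂ => 1 - u) 0 := by fun_prop
  have hpow : DifferentiableAt ℂ (fun u : ℂ => (2 * Real.pi : ℂ) ^ (-(1 - u))) 0 :=
    hsub.neg.const_cpow (Or.inl hπ)
  have hGamma : DifferentiableAt ℂ (fun u : ℂ => Complex.Gamma (1 - u)) 0 := by
    refine DifferentiableAt.comp (g := Complex.Gamma) 0 ?_ hsub
    refine Complex.differentiableAt_Gamma _ fun n hn => ?_
    have : ((1 + n : ℕ) : ℂ) = 0 := by
      push_cast
      linear_combination hn
    exact absurd (Nat.cast_eq_zero.1 this) (by omega)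
  have hcos : DifferentiableAt ℂ (fun u : ℂ => cosZeta a (1 - u)) 0 :=
    DifferentiableAt.comp (g := cosZeta a) 0 (differentiable_cosZeta_of_ne_zero ha _) hsub
  have hsin : HasDerivAt (fun u : ℂ => Complex.sin (Real.pi * u / 2)) (Real.pi / 2) 0 := by
    have := (((hasDerivAt_id (0 : ℂ)).const_mul (Real.pi : ℂ)).div_const 2).csin
    simpa using this
  have h := ((((hpow.const_mul 2).mul hGamma).mul hcos).hasDerivAt).mul hsin
  convert! h using 1
  simp only [Pi.mul_apply, sub_zero, mul_zero, zero_div, Complex.sin_zero, Complex.Gamma_one,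
    Complex.cpow_neg_one, zero_add]
  field_simp

lemma hurwitzZeta_add_hurwitzZeta_one_sub (a : ℝ) (s : ℂ) :
    hurwitzZeta a s + hurwitzZeta ((1 - a : ℝ) : UnitAddCircle) s = 2 * hurwitzZetaEven a s := by
  have : ((1 - a : ℝ) : UnitAddCircle) = -(a : UnitAddCircle) := by
    rw [AddCircle.coe_sub, AddCircle.coe_period, zero_sub]
  rw [this, hurwitzZetaEven_eq]
  ring

end

open HurwitzZeta Real in
/-- The analytic content of Proposition 5.3: the function
`F(s) = (π/r)^{−2s}·[ζ(2s, θ/π) + ζ(2s, 1 − θ/π) − ζ(2s, φ/π) − ζ(2s, 1 − φ/π)]`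
is differentiable at `s = 0`, `F'(0) = 2 log(sin φ / sin θ)`, and
`exp(−F'(0)) = sin²θ / sin²φ`. -/
theorem stmt_16 (r θ φ : ℝ) (hr : 0 < r)
    (hθ : 0 < θ ∧ θ < π / 2) (hφ : 0 < φ ∧ φ < π / 2)
    (F : ℂ → ℂ)
    (hF : F = fun s : ℂ => ((π / r : ℝ) : ℂ) ^ (-2 * s) *
        (hurwitzZeta ((θ / π : ℝ) : UnitAddCircle) (2 * s) +
          hurwitzZeta ((1 - θ / π : ℝ) : UnitAddCircle) (2 * s) -
          hurwitzZeta ((φ / π : ℝ) : UnitAddCircle) (2 * s) -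
          hurwitzZeta ((1 - φ / π : ℝ) : UnitAddCircle) (2 * s))) :
    DifferentiableAt ℂ F 0 ∧
    deriv F 0 = 2 * (Real.log (Real.sin φ / Real.sin θ) : ℂ) ∧
    Complex.exp (-deriv F 0) = (Real.sin θ : ℂ) ^ 2 / (Real.sin φ : ℂ) ^ 2 := by
  have mem : ∀ {x : ℝ}, 0 < x ∧ x < π / 2 → x / π ∈ Set.Ioo (0 : ℝ) 1 := fun {x} hx =>
    ⟨div_pos hx.1 pi_pos, (div_lt_one pi_pos).2 (by linarith [hx.2, pi_pos])⟩
  have hsinθ : 0 < Real.sin θ := sin_pos_of_pos_of_lt_pi hθ.1 (by linarith [hθ.2, pi_pos])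
  have hsinφ : 0 < Real.sin φ := sin_pos_of_pos_of_lt_pi hφ.1 (by linarith [hφ.2, pi_pos])
  have hF' : F = fun s : ℂ => ((π / r : ℝ) : ℂ) ^ (-2 * s) *
      (2 * hurwitzZetaEven ((θ / π : ℝ) : UnitAddCircle) (2 * s) -
        2 * hurwitzZetaEven ((φ / π : ℝ) : UnitAddCircle) (2 * s)) := by
    rw [hF]
    ext s
    rw [← hurwitzZeta_add_hurwitzZeta_one_sub, ← hurwitzZeta_add_hurwitzZeta_one_sub]
    ring
  have hscale : HasDerivAt (fun s : ℂ => 2 * s) 2 0 := by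
    simpa using (hasDerivAt_id (0 : ℂ)).const_mul 2
  have hzeta : ∀ {x : ℝ}, 0 < x ∧ x < π / 2 →
      HasDerivAt (fun s : ℂ => 2 * hurwitzZetaEven ((x / π : ℝ) : UnitAddCircle) (2 * s))
        (-2 * (Real.log (2 * Real.sin x) : ℂ)) 0 := by
    intro x hx
    have h0 := hasDerivAt_hurwitzZetaEven_zero (coe_unitAddCircle_ne_zero (mem hx))
    rw [cosZeta_one (mem hx), mul_div_cancel₀ _ pi_ne_zero] at h0
    have h1 := (HasDerivAt.comp_of_eq (0 : ℂ) h0 hscale (by simp)).const_mul 2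
    convert! h1 using 1
    ring
  have hzero : ∀ {x : ℝ}, 0 < x ∧ x < π / 2 →
      hurwitzZetaEven ((x / π : ℝ) : UnitAddCircle) 0 = 0 := fun {x} hx => by
    rw [hurwitzZetaEven_apply_zero, if_neg (coe_unitAddCircle_ne_zero (mem hx))]
  have hpow : DifferentiableAt ℂ (fun s : ℂ => ((π / r : ℝ) : ℂ) ^ (-2 * s)) 0 := by
    refine DifferentiableAt.const_cpow (by fun_prop) (Or.inl ?_)
    exact_mod_cast (div_pos pi_pos hr).ne'
  have hderiv : HasDerivAt F (2 * (Real.log (Real.sin φ / Real.sin θ) : ℂ)) 0 := by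
    have h := hpow.hasDerivAt.mul ((hzeta hθ).sub (hzeta hφ))
    rw [hF']
    convert! h using 1
    rw [Real.log_div hsinφ.ne' hsinθ.ne', Real.log_mul two_ne_zero hsinθ.ne',
      Real.log_mul two_ne_zero hsinφ.ne']
    simp only [Pi.sub_apply, mul_zero, hzero hθ, hzero hφ, Complex.cpow_zero]
    push_cast
    ring
  refine ⟨hderiv.differentiableAt, hderiv.deriv, ?_⟩
  have hexp : Real.exp (-(2 * Real.log (Real.sin φ / Real.sin θ))) =
      Real.sin θ ^ 2 / Real.sin φ ^ 2 := by
    rw [← mul_neg, ← Real.log_inv, inv_div, two_mul, Real.exp_add,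
      Real.exp_log (div_pos hsinθ hsinφ), ← sq, div_pow]
  rw [hderiv.deriv]
  exact_mod_cast congrArg (fun x : ℝ => (x : ℂ)) hexp
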